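/- Let b : ℕ → ℕ be a sequence with b n ≥ 2 for all n, let τ : X_b → X_b be a homeomorphism that is the odometer map for b, and let m ≥ 1. If (X_b, τ) admits a cyclic clopen partition of size m (pairwise disjoint nonempty clopen sets U_1, …, U_m covering X_b with τ '' U_i = U_{i+1} and τ '' U_m = U_1), then there exists l : ℕ such that m divides ∏_{i<l} b i. -/

import Mathlib

/-- `σ` is the odometer map (addition by one with carry) for the sequence `a`:
the all-max point is sent to the all-zeros point, and any other point `x`, with
least index `n₀` such that `x n₀ < a n₀ - 1`, is sent to the point which is `0`
below `n₀`, is `x n₀ + 1` at `n₀`, and agrees with `x` above `n₀`. -/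
def IsOdometerMap (a : ℕ → ℕ) (σ : (∀ n, Fin (a n)) → ∀ n, Fin (a n)) : Prop :=
  ∀ x : ∀ n, Fin (a n),
    ((∀ n, (x n : ℕ) = a n - 1) → ∀ i, (σ x i : ℕ) = 0) ∧
    (∀ n₀ : ℕ, (x n₀ : ℕ) < a n₀ - 1 → (∀ i < n₀, (x i : ℕ) = a i - 1) →
      (∀ i < n₀, (σ x i : ℕ) = 0) ∧ ((σ x n₀ : ℕ) = (x n₀ : ℕ) + 1) ∧
        ∀ i, n₀ < i → σ x i = x i)

/-- A cyclic clopen partition of size `m` of a dynamical system `(X, σ)`: a family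
`U : Fin m → Set X` of pairwise disjoint nonempty clopen sets whose union is `X`,
with `σ '' (U i) = U (i + 1)` for all `i` (indices taken mod `m`, via `finRotate`). -/
def IsCyclicClopenPartition {X : Type*} [TopologicalSpace X] (σ : X → X)
    {m : ℕ} (U : Fin m → Set X) : Prop :=
  (∀ i, IsClopen (U i)) ∧ (∀ i, (U i).Nonempty) ∧
    Pairwise (Function.onFun Disjoint U) ∧ (⋃ i, U i) = Set.univ ∧
    ∀ i, σ '' U i = U (finRotate m i)

namespace IsOdometerMap

open Finset

variable {b : ℕ → ℕ}

/-- The digits of `x` below position `l`, read as a number in the mixed radix system `b`. -/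
def digitValue (x : ∀ n, Fin (b n)) (l : ℕ) : ℕ :=
  ∑ i ∈ range l, (x i : ℕ) * ∏ j ∈ range i, b j

lemma eq_of_digitValue_modEq (x y : ∀ n, Fin (b n)) (l : ℕ)
    (h : digitValue x l ≡ digitValue y l [MOD ∏ i ∈ range l, b i]) :
    ∀ i < l, x i = y i := by
  induction l with
  | zero => simp
  | succ l ih =>
    have hpos : (∏ i ∈ range l, b i) ≠ 0 :=
      prod_ne_zero_iff.2 fun i _ => ((Nat.zero_le _).trans_lt (x i).isLt).ne'
    simp only [digitValue, sum_range_succ, prod_range_succ] at h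
    have hlow : ∀ i < l, x i = y i := by
      refine ih ?_
      have h' := h.of_mul_right (b l)
      simpa [Nat.ModEq, digitValue] using h'
    have hsum : ∑ i ∈ range l, (x i : ℕ) * ∏ j ∈ range i, b j =
        ∑ i ∈ range l, (y i : ℕ) * ∏ j ∈ range i, b j :=
      sum_congr rfl fun i hi => by rw [hlow i (mem_range.1 hi)]
    rw [hsum] at h
    have h2 := Nat.ModEq.add_left_cancel' _ h
    rw [mul_comm (x l : ℕ), mul_comm (y l : ℕ)] at h2
    have h3 := Nat.ModEq.mul_left_cancel' hpos h2
    have h4 : x l = y l := Fin.ext (h3.eq_of_lt_of_lt (x l).isLt (y l).isLt)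
    intro i hi
    rcases Nat.lt_succ_iff_lt_or_eq.1 hi with hi | rfl
    · exact hlow i hi
    · exact h4

variable {τ : (∀ n, Fin (b n)) → ∀ n, Fin (b n)}

lemma apply_of_carry (hτ : IsOdometerMap b τ) (x : ∀ n, Fin (b n)) (i : ℕ)
    (h : ∀ j ≤ i, (x j : ℕ) = b j - 1) : (τ x i : ℕ) = 0 := by
  classical
  by_cases hall : ∀ n, (x n : ℕ) = b n - 1
  · exact (hτ x).1 hall i
  · push Not at hall
    have hmin := fun j => Nat.find_min hall (m := j)
    have hspec := Nat.find_spec hall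
    have hlt : (x (Nat.find hall) : ℕ) < b (Nat.find hall) - 1 := by
      have := (x (Nat.find hall)).isLt
      omega
    refine ((hτ x).2 _ hlt fun j hj => not_not.1 (hmin j hj)).1 i ?_
    by_contra hle
    exact hspec (h _ (not_lt.1 hle))

lemma apply_of_not_carry (hτ : IsOdometerMap b τ) (x : ∀ n, Fin (b n)) (i : ℕ)
    (h : ¬ ∀ j < i, (x j : ℕ) = b j - 1) : τ x i = x i := by
  classical
  push Not at h
  have hmin := fun j => Nat.find_min h (m := j)
  obtain ⟨hi, hne⟩ := Nat.find_spec h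
  have hlt : (x (Nat.find h) : ℕ) < b (Nat.find h) - 1 := by
    have := (x (Nat.find h)).isLt
    omega
  refine ((hτ x).2 _ hlt fun j hj => ?_).2.2 i hi
  by_contra hj'
  exact hmin j hj ⟨hj.trans hi, hj'⟩

open Classical in
lemma digitValue_apply_add (hτ : IsOdometerMap b τ) (x : ∀ n, Fin (b n)) (l : ℕ) :
    digitValue (τ x) l + (if ∀ j < l, (x j : ℕ) = b j - 1 then ∏ i ∈ range l, b i else 0) =
      digitValue x l + 1 := by
  induction l with
  | zero => simp [digitValue]
  | succ l ih =>
    have hlt := (x l).isLt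
    simp only [digitValue, sum_range_succ, prod_range_succ] at ih ⊢
    by_cases hc : ∀ j < l, (x j : ℕ) = b j - 1
    · rw [if_pos hc] at ih
      by_cases hl : (x l : ℕ) = b l - 1
      · have hc' : ∀ j ≤ l, (x j : ℕ) = b j - 1 := fun j hj => by
          rcases hj.lt_or_eq with hj | rfl
          · exact hc j hj
          · exact hl
        rw [if_pos fun j hj => hc' j (Nat.lt_succ_iff.1 hj), hτ.apply_of_carry x l hc']
        have hb : b l = (x l : ℕ) + 1 := by omega
        linear_combination ih + (∏ i ∈ range l, b i) * hb
      · rw [if_neg fun h => hl (h l l.lt_succ_self), ((hτ x).2 l (by omega) hc).2.1]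
        linear_combination ih
    · rw [if_neg hc] at ih
      rw [if_neg fun h => hc fun j hj => h j (hj.trans l.lt_succ_self),
        hτ.apply_of_not_carry x l hc]
      linear_combination ih

lemma digitValue_iterate_modEq (hτ : IsOdometerMap b τ) (x : ∀ n, Fin (b n)) (l k : ℕ) :
    digitValue (τ^[k] x) l ≡ digitValue x l + k [MOD ∏ i ∈ range l, b i] := by
  classical
  induction k with
  | zero => rfl
  | succ k ih =>
    rw [Function.iterate_succ_apply', ← add_assoc]
    refine Nat.ModEq.trans ?_ (ih.add_right 1)
    rw [← hτ.digitValue_apply_add]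
    split_ifs <;> simp [Nat.ModEq]

/-- Iterating the odometer map `∏ i < l, b i` times fixes the first `l` digits. -/
lemma iterate_prod_apply (hτ : IsOdometerMap b τ) (x : ∀ n, Fin (b n)) (l : ℕ) :
    ∀ i < l, τ^[∏ i ∈ range l, b i] x i = x i := by
  refine eq_of_digitValue_modEq _ _ l ((hτ.digitValue_iterate_modEq x l _).trans ?_)
  simp [Nat.ModEq]

end IsOdometerMap

lemma IsCyclicClopenPartition.iterate_mem {X : Type*} [TopologicalSpace X] {σ : X → X} {n : ℕ}
    {U : Fin (n + 1) → Set X} (hU : IsCyclicClopenPartition σ U) {x : X} (hx : x ∈ U 0) (k : ℕ) :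
    σ^[k] x ∈ U (Fin.ofNat (n + 1) k) := by
  induction k with
  | zero => simpa using hx
  | succ k ih =>
    have hk : Fin.ofNat (n + 1) (k + 1) = finRotate (n + 1) (Fin.ofNat (n + 1) k) := by
      rw [finRotate_apply]
      exact Fin.ext (by simp [Fin.val_add])
    rw [Function.iterate_succ_apply', hk, ← hU.2.2.2.2]
    exact Set.mem_image_of_mem σ ih

/-- If an odometer for the sequence `b` admits a cyclic clopen partition of size
`m ≥ 1`, then `m` divides some partial product `∏_{i<l} b i`. -/
theorem dvd_partialProd_of_cyclicClopenPartition (b : ℕ → ℕ) (hb : ∀ n, 2 ≤ b n)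
    (τ : (∀ n, Fin (b n)) ≃ₜ (∀ n, Fin (b n))) (hτ : IsOdometerMap b τ)
    (m : ℕ) (hm : 1 ≤ m) (U : Fin m → Set (∀ n, Fin (b n)))
    (hU : IsCyclicClopenPartition τ U) :
    ∃ l : ℕ, m ∣ ∏ i ∈ Finset.range l, b i := by
  obtain ⟨n, rfl⟩ := Nat.exists_eq_add_of_le' hm
  obtain ⟨x, hx⟩ := hU.2.1 0
  obtain ⟨I, u, hu, hsub⟩ := isOpen_pi_iff.1 (hU.1 0).isOpen x hx
  set l := I.sup id + 1
  refine ⟨l, ?_⟩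
  have hmem : τ^[∏ i ∈ Finset.range l, b i] x ∈ U 0 := by
    refine hsub fun i hi => ?_
    rw [hτ.iterate_prod_apply x l i (Nat.lt_succ_iff.2 (Finset.le_sup (f := id) hi))]
    exact (hu i hi).2
  have hmem' := hU.iterate_mem hx (∏ i ∈ Finset.range l, b i)
  by_contra hdvd
  have hne : Fin.ofNat (n + 1) (∏ i ∈ Finset.range l, b i) ≠ 0 := fun h =>
    hdvd (Nat.dvd_of_mod_eq_zero (congrArg Fin.val h))
  exact Set.disjoint_left.1 (hU.2.2.1 hne) hmem' hmem
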